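/- arXiv:1803.06324 — 3 statements merged into one kernel-verified Lean document; each statement's English description precedes it below -/
import Mathlib

section
/- For every finite connected graph G, every vertex w, and every BFS-tree T rooted at w, τ(G) ≤ 8·ρ_{w,T}(G) + 4 ≤ 8·τ(G) + 4 and ς(G) ≤ 6·ρ_{w,T}(G) + 3 ≤ 24·ς(G) + 3. -/
open SimpleGraph

noncomputable section

namespace HypPaper

variable {V : Type*}

/-- Gromov product `(y|z)_w = (d(y,w)+d(z,w)-d(y,z))/2`. -/
def gp (G : SimpleGraph V) (y z w : V) : ℝ :=
  ((G.dist y w : ℝ) + (G.dist z w : ℝ) - (G.dist y z : ℝ)) / 2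

/-- `G` is `δ`-hyperbolic. -/
def IsDeltaHyp (G : SimpleGraph V) (δ : ℝ) : Prop :=
  ∀ w x y z : V, gp G x y w ≥ min (gp G x z w) (gp G y z w) - δ

/-- The hyperbolicity `δ(G)`: least `δ ≥ 0` such that `G` is `δ`-hyperbolic. -/
def hyperbolicity (G : SimpleGraph V) : ℝ :=
  sInf {δ : ℝ | 0 ≤ δ ∧ IsDeltaHyp G δ}

/-- Pointed hyperbolicity `δ_w(G)` with respect to basepoint `w`. -/
def pointedHyp (G : SimpleGraph V) (w : V) : ℝ :=
  sInf {δ : ℝ | ∀ x y z : V, gp G x y w ≥ min (gp G x z w) (gp G y z w) - δ}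

/-- A walk is a geodesic (shortest path) if its length equals the distance. -/
def IsGeodesic (G : SimpleGraph V) {x y : V} (p : G.Walk x y) : Prop :=
  p.length = G.dist x y

/-- Thinness condition at corner `v` of a triangle, with sides `p : v → u` and `q : v → u'`. -/
def ThinCorner (G : SimpleGraph V) (δ : ℝ) {v u u' : V}
    (p : G.Walk v u) (q : G.Walk v u') : Prop :=
  ∀ a ∈ p.support, ∀ b ∈ q.support,
    G.dist v a = G.dist v b → (G.dist v a : ℝ) ≤ gp G u u' v →
    (G.dist a b : ℝ) ≤ δ

/-- A geodesic triangle with sides `p : x → y`, `q : y → z`, `r : z → x` is `δ`-thin. -/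
def TriangleThin (G : SimpleGraph V) (δ : ℝ) {x y z : V}
    (p : G.Walk x y) (q : G.Walk y z) (r : G.Walk z x) : Prop :=
  ThinCorner G δ p r.reverse ∧ ThinCorner G δ q p.reverse ∧ ThinCorner G δ r q.reverse

/-- Thinness `τ(G)`: least `δ` such that every geodesic triangle is `δ`-thin. -/
def thinness (G : SimpleGraph V) : ℝ :=
  sInf {δ : ℝ | ∀ (x y z : V) (p : G.Walk x y) (q : G.Walk y z) (r : G.Walk z x),
    IsGeodesic G p → IsGeodesic G q → IsGeodesic G r → TriangleThin G δ p q r}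

/-- The insize `max {d(y_z,z_y), d(z_x,x_z), d(x_y,y_x)}` of a geodesic triangle with
sides `p : x → y`, `q : y → z`, `r : z → x`. -/
def triInsize (G : SimpleGraph V) {x y z : V}
    (p : G.Walk x y) (q : G.Walk y z) (r : G.Walk z x) : ℝ :=
  max (G.dist (p.getVert ⌊gp G y z x⌋₊) (r.reverse.getVert ⌊gp G y z x⌋₊) : ℝ)
    (max (G.dist (q.getVert ⌊gp G z x y⌋₊) (p.reverse.getVert ⌊gp G z x y⌋₊) : ℝ)
      (G.dist (r.getVert ⌊gp G x y z⌋₊) (q.reverse.getVert ⌊gp G x y z⌋₊) : ℝ))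

/-- Insize `ι(G)`: least upper bound on insizes of geodesic triangles. -/
def insize (G : SimpleGraph V) : ℝ :=
  sInf {δ : ℝ | ∀ (x y z : V) (p : G.Walk x y) (q : G.Walk y z) (r : G.Walk z x),
    IsGeodesic G p → IsGeodesic G q → IsGeodesic G r → triInsize G p q r ≤ δ}

/-- A geodesic triangle with sides `p : x → y`, `q : y → z`, `r : z → x` is `δ`-slim. -/
def TriangleSlim (G : SimpleGraph V) (δ : ℝ) {x y z : V}
    (p : G.Walk x y) (q : G.Walk y z) (r : G.Walk z x) : Prop :=
  (∀ a ∈ p.support, ∃ b, (b ∈ q.support ∨ b ∈ r.support) ∧ (G.dist a b : ℝ) ≤ δ) ∧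
  (∀ a ∈ q.support, ∃ b, (b ∈ r.support ∨ b ∈ p.support) ∧ (G.dist a b : ℝ) ≤ δ) ∧
  (∀ a ∈ r.support, ∃ b, (b ∈ p.support ∨ b ∈ q.support) ∧ (G.dist a b : ℝ) ≤ δ)

/-- Slimness `ς(G)`: least `δ` such that every geodesic triangle is `δ`-slim. -/
def slimness (G : SimpleGraph V) : ℝ :=
  sInf {δ : ℝ | ∀ (x y z : V) (p : G.Walk x y) (q : G.Walk y z) (r : G.Walk z x),
    IsGeodesic G p → IsGeodesic G q → IsGeodesic G r → TriangleSlim G δ p q r}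

/-- The metric interval `I(u,v)`. -/
def interval (G : SimpleGraph V) (u v : V) : Set V :=
  {x | G.dist u x + G.dist x v = G.dist u v}

/-- Interval thinness `κ(G)`. -/
def intervalThinness (G : SimpleGraph V) : ℝ :=
  sInf {κ : ℝ | ∀ x y a b : V, a ∈ interval G x y → b ∈ interval G x y →
    G.dist x a = G.dist x b → (G.dist a b : ℝ) ≤ κ}

/-- A BFS-tree of `G` rooted at `w`: a spanning tree (encoded by its parent function)
in which the path from `w` to any vertex is a shortest path of `G`. -/
structure BFSTree (G : SimpleGraph V) (w : V) where
  parent : V → V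
  parent_root : parent w = w
  adj_parent : ∀ x, x ≠ w → G.Adj (parent x) x
  dist_parent : ∀ x, x ≠ w → G.dist w (parent x) + 1 = G.dist w x

/-- The vertex of the tree path `[w,x]_T` at distance `r` from the root `w`
(for `r ≤ d(w,x)`). -/
def treeVert (G : SimpleGraph V) {w : V} (T : BFSTree G w) (x : V) (r : ℕ) : V :=
  T.parent^[G.dist w x - r] x

/-- `v` lies on the tree path `[w,x]_T`. -/
def onRootPath (G : SimpleGraph V) {w : V} (T : BFSTree G w) (x v : V) : Prop :=
  ∃ i ≤ G.dist w x, v = T.parent^[i] x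

/-- The rooted insize `ρ_{w,T}(G) = max {d(x_y, y_x) : x, y ∈ V}`, where `x_y`, `y_x` are
the vertices of `[w,x]_T`, `[w,y]_T` at distance `⌊(x|y)_w⌋` from `w`. -/
def rootedInsize (G : SimpleGraph V) {w : V} (T : BFSTree G w) : ℝ :=
  sSup {ρ : ℝ | ∃ x y : V,
    ρ = (G.dist (treeVert G T x ⌊gp G x y w⌋₊) (treeVert G T y ⌊gp G x y w⌋₊) : ℝ)}

/-- The rooted thinness `μ_{w,T}(G)`. -/
def rootedThinness (G : SimpleGraph V) {w : V} (T : BFSTree G w) : ℝ :=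
  sSup {μ : ℝ | ∃ x y x' y' : V, onRootPath G T x x' ∧ onRootPath G T y y' ∧
    G.dist w x' = G.dist w y' ∧ (G.dist w x' : ℝ) ≤ gp G x y w ∧
    μ = (G.dist x' y' : ℝ)}

section Distances

variable {G : SimpleGraph V}

lemma floor_gp (hG : G.Connected) (x y w : V) :
    ⌊gp G x y w⌋₊ = (G.dist x w + G.dist y w - G.dist x y) / 2 := by
  have h : G.dist x y ≤ G.dist x w + G.dist y w := by
    rw [G.dist_comm (u := y)]; exact hG.dist_triangle
  have h' : gp G x y w = ((G.dist x w + G.dist y w - G.dist x y : ℕ) : ℝ) / (2 : ℕ) := by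
    unfold gp; push_cast [Nat.cast_sub h]; ring
  rw [h', Nat.floor_div_eq_div]

lemma IsGeodesic.dist_add_dist (hG : G.Connected) {x y a : V} {p : G.Walk x y}
    (hp : IsGeodesic G p) (ha : a ∈ p.support) :
    G.dist x a + G.dist a y = G.dist x y := by
  obtain ⟨q, r, rfl⟩ := Walk.mem_support_iff_exists_append.mp ha
  unfold IsGeodesic at hp
  rw [Walk.length_append] at hp
  have := dist_le q
  have := dist_le r
  have := hG.dist_triangle (u := x) (v := a) (w := y)
  omega

lemma IsGeodesic.reverse {x y : V} {p : G.Walk x y} (hp : IsGeodesic G p) :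
    IsGeodesic G p.reverse := by
  unfold IsGeodesic at *
  rw [Walk.length_reverse, hp, dist_comm]

lemma IsGeodesic.exists_mem_support_dist_eq (hG : G.Connected) {x y : V} {p : G.Walk x y}
    (hp : IsGeodesic G p) {t : ℕ} (ht : t ≤ G.dist x y) :
    ∃ b ∈ p.support, G.dist x b = t ∧ G.dist b y = G.dist x y - t := by
  refine ⟨p.getVert t, p.getVert_mem_support t, ?_⟩
  unfold IsGeodesic at hp
  have h₁ := dist_le (p.take t)
  have h₂ := dist_le (p.drop t)
  rw [Walk.take_length] at h₁
  rw [Walk.drop_length] at h₂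
  have := hG.dist_triangle (u := x) (v := p.getVert t) (w := y)
  omega

lemma IsGeodesic.dist_add_dist_of_mem_mem (hG : G.Connected) {x y a b : V} {p : G.Walk x y}
    (hp : IsGeodesic G p) (ha : a ∈ p.support) (hb : b ∈ p.support) :
    G.dist x a + G.dist a b = G.dist x b ∨ G.dist x b + G.dist a b = G.dist x a := by
  have hxa := hp.dist_add_dist hG ha
  have hxb := hp.dist_add_dist hG hb
  obtain ⟨q, r, rfl⟩ := Walk.mem_support_iff_exists_append.mp ha
  have hq := dist_le q
  have hr := dist_le r
  unfold IsGeodesic at hp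
  rw [Walk.length_append] at hp
  rw [Walk.mem_support_append_iff] at hb
  rcases hb with hb | hb
  · have hxba := IsGeodesic.dist_add_dist hG (p := q) (by unfold IsGeodesic; omega) hb
    rw [G.dist_comm (u := a)]
    exact .inr hxba
  · have haby := IsGeodesic.dist_add_dist hG (p := r) (by unfold IsGeodesic; omega) hb
    left
    omega

lemma exists_isGeodesic_through (hG : G.Connected) {x y a : V}
    (h : G.dist x a + G.dist a y = G.dist x y) :
    ∃ p : G.Walk x y, IsGeodesic G p ∧ a ∈ p.support := by
  obtain ⟨q, hq⟩ := hG.exists_walk_length_eq_dist x a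
  obtain ⟨r, hr⟩ := hG.exists_walk_length_eq_dist a y
  refine ⟨q.append r, ?_, by simp⟩
  rw [IsGeodesic, Walk.length_append, hq, hr, h]

end Distances

section FourPoint

variable {G : SimpleGraph V}

/-- The four-point condition at the base point `w`, with additive constant `C`; it says that the
pointed hyperbolicity at `w` is at most `C / 2`. -/
def FourPointAt (G : SimpleGraph V) (C : ℕ) (w : V) : Prop :=
  ∀ x y z, G.dist x y + G.dist z w ≤
    max (G.dist x z + G.dist y w) (G.dist y z + G.dist x w) + C

lemma FourPointAt.of_basepoint {C : ℕ} {w : V} (h : FourPointAt G C w) (t : V) :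
    FourPointAt G (2 * C) t := by
  intro x y z
  have h₁ := h x y z
  have h₂ := h x y t
  have h₃ := h z t x
  have h₄ := h z t y
  have := G.dist_comm (u := z) (v := x)
  have := G.dist_comm (u := z) (v := y)
  have := G.dist_comm (u := t) (v := x)
  have := G.dist_comm (u := t) (v := y)
  omega

lemma thinCorner_of_fourPointAt (hG : G.Connected) {C : ℕ} {v u u' : V}
    (h : FourPointAt G C v) {p : G.Walk v u} {q : G.Walk v u'} (hp : IsGeodesic G p)
    (hq : IsGeodesic G q) : ThinCorner G (2 * C : ℕ) p q := by
  intro a ha b hb hab hgp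
  have hgp' : 2 * G.dist v a + G.dist u u' ≤ G.dist u v + G.dist u' v := by
    unfold gp at hgp
    have : (2 * G.dist v a + G.dist u u' : ℝ) ≤ G.dist u v + G.dist u' v := by linarith
    exact_mod_cast this
  have h₁ := hp.dist_add_dist hG ha
  have h₂ := hq.dist_add_dist hG hb
  have h₃ := h a u' u
  have h₄ := h a b u'
  have := G.dist_comm (u := u) (v := v)
  have := G.dist_comm (u := u') (v := v)
  have := G.dist_comm (u := a) (v := v)
  have := G.dist_comm (u := b) (v := v)
  have := G.dist_comm (u := u') (v := u)
  rw [Nat.cast_le]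
  omega

lemma exists_mem_support_dist_le_of_fourPointAt (hG : G.Connected) {c k : ℕ} {a y z : V}
    (h : FourPointAt G (2 * c) a) {q : G.Walk y z} (hq : IsGeodesic G q)
    (ha : G.dist a y + G.dist a z ≤ G.dist y z + 2 * k) :
    ∃ b ∈ q.support, G.dist a b ≤ k + 2 * c := by
  have t₁ := hG.dist_triangle (u := a) (v := y) (w := z)
  have t₂ := hG.dist_triangle (u := a) (v := z) (w := y)
  have t₃ := hG.dist_triangle (u := y) (v := a) (w := z)
  have := G.dist_comm (u := y) (v := a)
  have := G.dist_comm (u := z) (v := a)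
  have := G.dist_comm (u := z) (v := y)
  obtain ⟨b, hb, hyb, hbz⟩ := hq.exists_mem_support_dist_eq hG
    (t := (G.dist a y + G.dist y z - G.dist a z) / 2) (by omega)
  refine ⟨b, hb, ?_⟩
  have h₁ := h y z b
  have := G.dist_comm (u := b) (v := a)
  have := G.dist_comm (u := b) (v := z)
  omega

lemma exists_near_of_fourPointAt (hG : G.Connected) {c : ℕ} (h : ∀ v, FourPointAt G (2 * c) v)
    {x y z a : V} {p : G.Walk x y} {q : G.Walk y z} {r : G.Walk z x} (hp : IsGeodesic G p)
    (hq : IsGeodesic G q) (hr : IsGeodesic G r) (ha : a ∈ p.support) :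
    ∃ b, (b ∈ q.support ∨ b ∈ r.support) ∧ (G.dist a b : ℝ) ≤ (3 * c : ℕ) := by
  have h₁ := hp.dist_add_dist hG ha
  have h₂ := h a x y z
  have := G.dist_comm (u := x) (v := a)
  have := G.dist_comm (u := y) (v := a)
  have := G.dist_comm (u := z) (v := a)
  have := G.dist_comm (u := x) (v := z)
  by_cases hc : G.dist a y + G.dist a z ≤ G.dist y z + 2 * c
  · obtain ⟨b, hb, hab⟩ := exists_mem_support_dist_le_of_fourPointAt hG (h a) hq hc
    exact ⟨b, .inl hb, by rw [Nat.cast_le]; omega⟩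
  · obtain ⟨b, hb, hab⟩ := exists_mem_support_dist_le_of_fourPointAt hG (h a) hr (k := c)
      (by omega)
    exact ⟨b, .inr hb, by rw [Nat.cast_le]; omega⟩

lemma triangleThin_of_fourPointAt (hG : G.Connected) {C : ℕ} (h : ∀ v, FourPointAt G C v)
    {x y z : V} {p : G.Walk x y} {q : G.Walk y z} {r : G.Walk z x} (hp : IsGeodesic G p)
    (hq : IsGeodesic G q) (hr : IsGeodesic G r) : TriangleThin G (2 * C : ℕ) p q r :=
  ⟨thinCorner_of_fourPointAt hG (h x) hp hr.reverse,
    thinCorner_of_fourPointAt hG (h y) hq hp.reverse,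
    thinCorner_of_fourPointAt hG (h z) hr hq.reverse⟩

lemma triangleSlim_of_fourPointAt (hG : G.Connected) {c : ℕ}
    (h : ∀ v, FourPointAt G (2 * c) v) {x y z : V} {p : G.Walk x y} {q : G.Walk y z}
    {r : G.Walk z x} (hp : IsGeodesic G p) (hq : IsGeodesic G q) (hr : IsGeodesic G r) :
    TriangleSlim G (3 * c : ℕ) p q r :=
  ⟨fun _ => exists_near_of_fourPointAt hG h hp hq hr,
    fun _ => exists_near_of_fourPointAt hG h hq hr hp,
    fun _ => exists_near_of_fourPointAt hG h hr hp hq⟩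

lemma TriangleThin.nonneg {δ : ℝ} {x : V}
    (h : TriangleThin G δ (.nil : G.Walk x x) .nil .nil) : 0 ≤ δ := by
  simpa using h.1 x (by simp) x (by simp) rfl (by simp [gp])

lemma TriangleSlim.nonneg {δ : ℝ} {x y z : V} {p : G.Walk x y} {q : G.Walk y z}
    {r : G.Walk z x} (h : TriangleSlim G δ p q r) : 0 ≤ δ := by
  obtain ⟨b, -, hb⟩ := h.1 x p.start_mem_support
  exact (Nat.cast_nonneg _).trans hb

/-- In a `δ`-slim geodesic triangle, points at distance `⌊(x|y)_w⌋` from `w` on the two sides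
issuing from `w` are at distance at most `4 * δ`. -/
lemma TriangleSlim.dist_le (hG : G.Connected) {δ : ℝ} {w x y a b : V} {p : G.Walk w x}
    {q : G.Walk x y} {r : G.Walk y w} (h : TriangleSlim G δ p q r) (hp : IsGeodesic G p)
    (hq : IsGeodesic G q) (hr : IsGeodesic G r) (ha : a ∈ p.support) (hb : b ∈ r.support)
    (hwa : G.dist w a = ⌊gp G x y w⌋₊) (hwb : G.dist w b = ⌊gp G x y w⌋₊) :
    (G.dist a b : ℝ) ≤ 4 * δ := by
  obtain ⟨a', ha', haa⟩ := h.1 a ha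
  obtain ⟨b', hb', hbb⟩ := h.2.2 b hb
  rw [← Nat.le_floor_iff h.nonneg] at haa hbb
  set D := ⌊δ⌋₊
  suffices H : G.dist a b ≤ 4 * D by
    have H' : (G.dist a b : ℝ) ≤ 4 * D := by exact_mod_cast H
    linarith [Nat.floor_le h.nonneg]
  rw [floor_gp hG] at hwa hwb
  have hpa := hp.dist_add_dist hG ha
  have hrb := hr.dist_add_dist hG hb
  have := hG.dist_triangle (u := x) (v := w) (w := y)
  have := hG.dist_triangle (u := a) (v := a') (w := b)
  have := hG.dist_triangle (u := a) (v := b') (w := b)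
  have := hG.dist_triangle (u := a) (v := a') (w := b')
  have := G.dist_comm (u := w) (v := x)
  have := G.dist_comm (u := w) (v := y)
  have := G.dist_comm (u := w) (v := b)
  have := G.dist_comm (u := b) (v := b')
  rcases ha' with ha' | ha'
  · rcases hb' with hb' | hb'
    · have := hp.dist_add_dist_of_mem_mem hG ha hb'
      have := hG.dist_triangle (u := w) (v := b) (w := b')
      have := hG.dist_triangle (u := w) (v := b') (w := b)
      omega
    · have := hq.dist_add_dist_of_mem_mem hG ha' hb'
      have := hq.dist_add_dist hG ha'
      have := hq.dist_add_dist hG hb'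
      have := hG.dist_triangle (u := w) (v := a) (w := a')
      have := hG.dist_triangle (u := w) (v := a') (w := y)
      have := hG.dist_triangle (u := w) (v := b) (w := b')
      have := hG.dist_triangle (u := w) (v := b') (w := x)
      have := hG.dist_triangle (u := x) (v := a') (w := a)
      have := hG.dist_triangle (u := b) (v := b') (w := y)
      have := hG.dist_triangle (u := a') (v := b') (w := b)
      have := G.dist_comm (u := a) (v := a')
      have := G.dist_comm (u := a) (v := x)
      have := G.dist_comm (u := b) (v := y)
      have := G.dist_comm (u := b') (v := x)
      omega
  · have := hr.dist_add_dist_of_mem_mem hG ha' hb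
    have := hr.dist_add_dist hG ha'
    have := hG.dist_triangle (u := w) (v := a) (w := a')
    have := hG.dist_triangle (u := w) (v := a') (w := a)
    have := G.dist_comm (u := a) (v := a')
    have := G.dist_comm (u := w) (v := a')
    omega

end FourPoint

section Tree

variable {G : SimpleGraph V} {w : V}

lemma BFSTree.dist_iterate_parent_le (T : BFSTree G w) (hG : G.Connected) (x : V) (i : ℕ) :
    G.dist (T.parent^[i] x) x ≤ i := by
  induction i with
  | zero => simp
  | succ i ih =>
    rw [Function.iterate_succ_apply']
    by_cases h : T.parent^[i] x = w
    · rw [h, T.parent_root, ← h]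
      omega
    · have := hG.dist_triangle (u := T.parent (T.parent^[i] x)) (v := T.parent^[i] x) (w := x)
      have := dist_eq_one_iff_adj.mpr (T.adj_parent _ h)
      omega

lemma BFSTree.dist_root_iterate_parent (T : BFSTree G w) (x : V) {i : ℕ}
    (hi : i ≤ G.dist w x) : G.dist w (T.parent^[i] x) = G.dist w x - i := by
  induction i with
  | zero => simp
  | succ i ih =>
    have ih := ih (by omega)
    rw [Function.iterate_succ_apply']
    have h : T.parent^[i] x ≠ w := by
      intro h
      rw [h, dist_self] at ih
      omega
    have := T.dist_parent _ h
    omega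

lemma dist_root_treeVert (T : BFSTree G w) {x : V} {r : ℕ} (hr : r ≤ G.dist w x) :
    G.dist w (treeVert G T x r) = r := by
  rw [treeVert, T.dist_root_iterate_parent x (by omega)]
  omega

lemma dist_treeVert_le (T : BFSTree G w) (hG : G.Connected) (x : V) (r : ℕ) :
    G.dist (treeVert G T x r) x ≤ G.dist w x - r :=
  T.dist_iterate_parent_le hG x _

lemma dist_treeVert_treeVert_le (T : BFSTree G w) (hG : G.Connected) {x : V} {r s : ℕ}
    (hrs : r ≤ s) (hs : s ≤ G.dist w x) :
    G.dist (treeVert G T x r) (treeVert G T x s) ≤ s - r := by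
  unfold treeVert
  rw [show G.dist w x - r = (s - r) + (G.dist w x - s) by omega, Function.iterate_add_apply]
  exact T.dist_iterate_parent_le hG _ _

lemma exists_isGeodesic_through_treeVert (T : BFSTree G w) (hG : G.Connected) {x : V} {r : ℕ}
    (hr : r ≤ G.dist w x) :
    ∃ p : G.Walk w x, IsGeodesic G p ∧ treeVert G T x r ∈ p.support := by
  refine exists_isGeodesic_through hG ?_
  have := dist_root_treeVert T hr
  have := dist_treeVert_le T hG x r
  have := hG.dist_triangle (u := w) (v := treeVert G T x r) (w := x)
  omega

lemma floor_gp_le_left (hG : G.Connected) (x y w : V) : ⌊gp G x y w⌋₊ ≤ G.dist w x := by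
  rw [floor_gp hG, G.dist_comm (u := w)]
  have := hG.dist_triangle (u := y) (v := x) (w := w)
  have := G.dist_comm (u := x) (v := y)
  omega

lemma floor_gp_le_right (hG : G.Connected) (x y w : V) : ⌊gp G x y w⌋₊ ≤ G.dist w y := by
  rw [floor_gp hG, G.dist_comm (u := w)]
  have := hG.dist_triangle (u := x) (v := y) (w := w)
  omega

lemma fourPointAt_of_treeVert_dist_le (T : BFSTree G w) (hG : G.Connected) {R : ℕ}
    (hR : ∀ x y, G.dist (treeVert G T x ⌊gp G x y w⌋₊) (treeVert G T y ⌊gp G x y w⌋₊) ≤ R) :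
    FourPointAt G (2 * R + 1) w := by
  have key : ∀ x y z, ⌊gp G x z w⌋₊ ≤ ⌊gp G z y w⌋₊ →
      G.dist x y + G.dist z w ≤ G.dist x z + G.dist y w + (2 * R + 1) := by
    intro x y z hle
    have hxz := hR x z
    have hzy := hR z y
    have hαx := floor_gp_le_left hG x z w
    have hβz := floor_gp_le_left hG z y w
    have hβy := floor_gp_le_right hG z y w
    have hα := floor_gp hG x z w
    set α := ⌊gp G x z w⌋₊
    set β := ⌊gp G z y w⌋₊
    have h₁ := dist_treeVert_le T hG x α
    have h₂ := dist_treeVert_treeVert_le T hG hle hβz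
    have h₃ := dist_treeVert_le T hG y β
    have := hG.dist_triangle (u := x) (v := treeVert G T x α) (w := y)
    have := hG.dist_triangle (u := treeVert G T x α) (v := treeVert G T z α) (w := y)
    have := hG.dist_triangle (u := treeVert G T z α) (v := treeVert G T z β) (w := y)
    have := hG.dist_triangle (u := treeVert G T z β) (v := treeVert G T y β) (w := y)
    have := hG.dist_triangle (u := x) (v := w) (w := z)
    have := G.dist_comm (u := x) (v := treeVert G T x α)
    have := G.dist_comm (u := w) (v := x)
    have := G.dist_comm (u := w) (v := y)
    have := G.dist_comm (u := w) (v := z)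
    omega
  intro x y z
  have := G.dist_comm (u := x) (v := y)
  rcases le_total ⌊gp G x z w⌋₊ ⌊gp G z y w⌋₊ with h | h
  · have := key x y z h
    omega
  · have gp_comm : ∀ a b, gp G a b w = gp G b a w := fun a b => by
      unfold gp; rw [G.dist_comm (u := a) (v := b)]; ring
    have := key y x z (by rwa [gp_comm y z, gp_comm z x])
    omega

end Tree

/-- `τ(G) ≤ 8·ρ_{w,T}(G) + 4 ≤ 8·τ(G) + 4` and `ς(G) ≤ 6·ρ_{w,T}(G) + 3 ≤ 24·ς(G) + 3`. -/
theorem thinness_slimness_approx_rootedInsize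
    {V : Type*} [Fintype V] (G : SimpleGraph V) (hG : G.Connected)
    (w : V) (T : BFSTree G w) :
    (thinness G ≤ 8 * rootedInsize G T + 4 ∧
      8 * rootedInsize G T + 4 ≤ 8 * thinness G + 4) ∧
    (slimness G ≤ 6 * rootedInsize G T + 3 ∧
      6 * rootedInsize G T + 3 ≤ 24 * slimness G + 3) := by
  have hle : ∀ x y, (G.dist (treeVert G T x ⌊gp G x y w⌋₊)
      (treeVert G T y ⌊gp G x y w⌋₊) : ℝ) ≤ rootedInsize G T := by
    intro x y
    refine le_csSup ?_ ⟨x, y, rfl⟩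
    refine ((Set.finite_range fun v : V × V => (G.dist (treeVert G T v.1 ⌊gp G v.1 v.2 w⌋₊)
      (treeVert G T v.2 ⌊gp G v.1 v.2 w⌋₊) : ℝ)).subset ?_).bddAbove
    rintro _ ⟨x, y, rfl⟩
    exact ⟨(x, y), rfl⟩
  have insize_le : ∀ δ : ℝ, (∀ x y, (G.dist (treeVert G T x ⌊gp G x y w⌋₊)
      (treeVert G T y ⌊gp G x y w⌋₊) : ℝ) ≤ δ) → rootedInsize G T ≤ δ := by
    intro δ h
    refine csSup_le ⟨_, w, w, rfl⟩ ?_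
    rintro _ ⟨x, y, rfl⟩
    exact h x y
  have hρ : 0 ≤ rootedInsize G T := (Nat.cast_nonneg _).trans (hle w w)
  set R := ⌊rootedInsize G T⌋₊
  have hRle : (R : ℝ) ≤ rootedInsize G T := Nat.floor_le hρ
  have h4 : ∀ v, FourPointAt G (2 * (2 * R + 1)) v :=
    (fourPointAt_of_treeVert_dist_le T hG fun x y => Nat.le_floor (hle x y)).of_basepoint
  have thin := fun (x y z : V) (p : G.Walk x y) (q : G.Walk y z) (r : G.Walk z x)
    (hp : IsGeodesic G p) (hq : IsGeodesic G q) (hr : IsGeodesic G r) =>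
      triangleThin_of_fourPointAt hG h4 hp hq hr
  have slim := fun (x y z : V) (p : G.Walk x y) (q : G.Walk y z) (r : G.Walk z x)
    (hp : IsGeodesic G p) (hq : IsGeodesic G q) (hr : IsGeodesic G r) =>
      triangleSlim_of_fourPointAt hG h4 hp hq hr
  have nil_geodesic : IsGeodesic G (.nil : G.Walk w w) := by simp [IsGeodesic]
  have thin_le : thinness G ≤ (2 * (2 * (2 * R + 1)) : ℕ) :=
    csInf_le ⟨0, fun δ h => (h w w w .nil .nil .nil nil_geodesic nil_geodesic
      nil_geodesic).nonneg⟩ thin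
  have slim_le : slimness G ≤ (3 * (2 * R + 1) : ℕ) :=
    csInf_le ⟨0, fun δ h => (h w w w .nil .nil .nil nil_geodesic nil_geodesic
      nil_geodesic).nonneg⟩ slim
  have le_thin : rootedInsize G T ≤ thinness G := by
    refine le_csInf ⟨_, thin⟩ fun δ h => insize_le δ fun x y => ?_
    have hx := floor_gp_le_left hG x y w
    have hy := floor_gp_le_right hG x y w
    obtain ⟨p, hp, ha⟩ := exists_isGeodesic_through_treeVert T hG hx
    obtain ⟨r, hr, hb⟩ := exists_isGeodesic_through_treeVert T hG hy
    obtain ⟨q, hq⟩ := hG.exists_walk_length_eq_dist x y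
    refine (h w x y p q r.reverse hp hq hr.reverse).1 _ ha _ (by simpa using hb) ?_ ?_
    · rw [dist_root_treeVert T hx, dist_root_treeVert T hy]
    · rw [dist_root_treeVert T hx]
      refine Nat.floor_le ?_
      have := hG.dist_triangle (u := x) (v := w) (w := y)
      rw [G.dist_comm (u := w)] at this
      have : (G.dist x y : ℝ) ≤ G.dist x w + G.dist y w := by exact_mod_cast this
      unfold gp
      linarith
  have le_slim : rootedInsize G T / 4 ≤ slimness G := by
    refine le_csInf ⟨_, slim⟩ fun δ h => ?_
    suffices rootedInsize G T ≤ 4 * δ by linarith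
    refine insize_le _ fun x y => ?_
    have hx := floor_gp_le_left hG x y w
    have hy := floor_gp_le_right hG x y w
    obtain ⟨p, hp, ha⟩ := exists_isGeodesic_through_treeVert T hG hx
    obtain ⟨r, hr, hb⟩ := exists_isGeodesic_through_treeVert T hG hy
    obtain ⟨q, hq⟩ := hG.exists_walk_length_eq_dist x y
    exact (h w x y p q r.reverse hp hq hr.reverse).dist_le hG hp hq hr.reverse ha
      (by simpa using hb) (dist_root_treeVert T hx) (dist_root_treeVert T hy)
  push_cast at thin_le slim_le
  refine ⟨⟨?_, ?_⟩, ?_, ?_⟩ <;> linarith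

end HypPaper
end
end

section
/- Let G be a finite connected graph, w a vertex, and k an integer. Then ς_w(G) ≤ k if and only if for all vertices x,y with w ∈ I(x,y) and every vertex z, min{p_w(x,z), p_w(y,z)} ≤ k. -/
open SimpleGraph

noncomputable section

namespace HypPaper

variable {V : Type*}

/-- `p_w(y,z)`: the least integer `k` such that for every geodesic `[y,z]`,
the distance from `w` to (the vertex set of) `[y,z]` is at most `k`. -/
def pMin (G : SimpleGraph V) (w y z : V) : ℕ :=
  sInf {k : ℕ | ∀ p : G.Walk y z, IsGeodesic G p → ∃ v ∈ p.support, G.dist w v ≤ k}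

/-- The pointed slimness `ς_w(G)`: the least integer `k` such that in every geodesic triangle
`Δ(x,y,z)` with `w` on the side `[x,y]`, `d(w, [x,z] ∪ [y,z]) ≤ k`. -/
def pointedSlimness (G : SimpleGraph V) (w : V) : ℕ :=
  sInf {k : ℕ | ∀ (x y z : V) (p : G.Walk x y) (q : G.Walk x z) (r : G.Walk y z),
    IsGeodesic G p → IsGeodesic G q → IsGeodesic G r → w ∈ p.support →
    ∃ v, (v ∈ q.support ∨ v ∈ r.support) ∧ G.dist w v ≤ k}

theorem sInf_le_iff_mem_of_isUpperSet {S : Set ℕ} (hS : IsUpperSet S) (hne : S.Nonempty)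
    {k : ℕ} : sInf S ≤ k ↔ k ∈ S :=
  ⟨fun h => hS h (Nat.sInf_mem hne), Nat.sInf_le⟩

theorem pMin_le_iff (G : SimpleGraph V) (w y z : V) (k : ℕ) :
    pMin G w y z ≤ k ↔
      ∀ p : G.Walk y z, IsGeodesic G p → ∃ v ∈ p.support, G.dist w v ≤ k := by
  refine sInf_le_iff_mem_of_isUpperSet ?_ ?_
  · intro a b hab h p hp
    obtain ⟨v, hv, hvk⟩ := h p hp
    exact ⟨v, hv, hvk.trans hab⟩
  · exact ⟨G.dist w y, fun p _ => ⟨y, p.start_mem_support, le_rfl⟩⟩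

theorem pointedSlimness_le_iff_forall_triangle [Fintype V] (G : SimpleGraph V) (w : V) (k : ℕ) :
    pointedSlimness G w ≤ k ↔
      ∀ (x y z : V) (p : G.Walk x y) (q : G.Walk x z) (r : G.Walk y z),
        IsGeodesic G p → IsGeodesic G q → IsGeodesic G r → w ∈ p.support →
        ∃ v, (v ∈ q.support ∨ v ∈ r.support) ∧ G.dist w v ≤ k := by
  refine sInf_le_iff_mem_of_isUpperSet ?_ ?_
  · intro a b hab h x y z p q r hp hq hr hw
    obtain ⟨v, hv, hvk⟩ := h x y z p q r hp hq hr hw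
    exact ⟨v, hv, hvk.trans hab⟩
  · exact ⟨Finset.univ.sup (G.dist w), fun x y z p q r _ _ _ _ =>
      ⟨x, Or.inl q.start_mem_support, Finset.le_sup (Finset.mem_univ x)⟩⟩

theorem IsGeodesic.mem_interval {G : SimpleGraph V} (hG : G.Connected) {x y w : V}
    {p : G.Walk x y} (hp : IsGeodesic G p) (hw : w ∈ p.support) : w ∈ interval G x y := by
  obtain ⟨q, r, rfl⟩ := SimpleGraph.Walk.mem_support_iff_exists_append.mp hw
  refine le_antisymm ?_ hG.dist_triangle
  rw [← hp, SimpleGraph.Walk.length_append]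
  exact add_le_add (dist_le q) (dist_le r)

theorem exists_isGeodesic_mem_support_of_mem_interval {G : SimpleGraph V} (hG : G.Connected)
    {x y w : V} (hw : w ∈ interval G x y) :
    ∃ p : G.Walk x y, IsGeodesic G p ∧ w ∈ p.support := by
  obtain ⟨q, hq⟩ := hG.exists_walk_length_eq_dist x w
  obtain ⟨r, hr⟩ := hG.exists_walk_length_eq_dist w y
  refine ⟨q.append r, ?_, SimpleGraph.Walk.mem_support_append_iff q r |>.mpr
    (Or.inl q.end_mem_support)⟩
  rw [IsGeodesic, SimpleGraph.Walk.length_append, hq, hr]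
  exact hw

/-- `ς_w(G) ≤ k` iff for all `x, y` with `w ∈ I(x,y)` and all `z`,
`min{p_w(x,z), p_w(y,z)} ≤ k`. -/
theorem pointedSlimness_le_iff
    {V : Type*} [Fintype V] (G : SimpleGraph V) (hG : G.Connected) (w : V) (k : ℕ) :
    pointedSlimness G w ≤ k ↔
      ∀ x y z : V, w ∈ interval G x y → min (pMin G w x z) (pMin G w y z) ≤ k := by
  rw [pointedSlimness_le_iff_forall_triangle]
  constructor
  · intro h x y z hw
    obtain ⟨p, hp, hwp⟩ := exists_isGeodesic_mem_support_of_mem_interval hG hw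
    rw [min_le_iff, pMin_le_iff, pMin_le_iff]
    by_contra! hcon
    obtain ⟨⟨q, hq, hqk⟩, r, hr, hrk⟩ := hcon
    obtain ⟨v, hv | hv, hvk⟩ := h x y z p q r hp hq hr hwp
    · exact (hqk v hv).not_ge hvk
    · exact (hrk v hv).not_ge hvk
  · intro h x y z p q r hp hq hr hwp
    have hmin := h x y z (hp.mem_interval hG hwp)
    rw [min_le_iff, pMin_le_iff, pMin_le_iff] at hmin
    rcases hmin with hxz | hyz
    · obtain ⟨v, hv, hvk⟩ := hxz q hq
      exact ⟨v, Or.inl hv, hvk⟩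
    · obtain ⟨v, hv, hvk⟩ := hyz r hr
      exact ⟨v, Or.inr hv, hvk⟩

end HypPaper
end
end

section
/- Let (X,d) be a complete geodesic metric space. Then for each pair of points x,y ∈ X one can choose an (x,y)-geodesic γ_{x,y} : [0,d(x,y)] → X such that for all x,y ∈ X and all points u,v lying on the image of γ_{x,y}, the image of γ_{u,v} is contained in the image of γ_{x,y}. -/
noncomputable section

/-- `γ : ℝ → X` (restricted to `[0, d(x,y)]`) is an `(x,y)`-geodesic: `γ 0 = x`,
`γ (d(x,y)) = y`, and `d(γ s, γ t) = |s − t|` for all `s, t ∈ [0, d(x,y)]`. -/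
def IsGeodesicMap {X : Type*} [MetricSpace X] (x y : X) (γ : ℝ → X) : Prop :=
  γ 0 = x ∧ γ (dist x y) = y ∧
    ∀ s ∈ Set.Icc (0 : ℝ) (dist x y), ∀ t ∈ Set.Icc (0 : ℝ) (dist x y),
      dist (γ s) (γ t) = |s - t|

/-- The greedy maximal chain between `x` and `y`: running through a well-ordering of `X`, a point
`z` lying metrically between `x` and `y` is selected whenever it is aligned with all the points
selected before it. -/
def greedyChain {X : Type*} [MetricSpace X] (x y : X) : X → Prop :=
  (IsWellFounded.wf (r := WellOrderingRel (α := X))).fix fun z ih =>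
    dist x z + dist z y = dist x y ∧
      ∀ w (h : WellOrderingRel w z), ih w h → dist w z = |dist x w - dist x z|

namespace greedyChain

variable {X : Type*} [MetricSpace X] {x y u v w z : X}

theorem iff_forall_lt : greedyChain x y z ↔ dist x z + dist z y = dist x y ∧
    ∀ w, WellOrderingRel w z → greedyChain x y w → dist w z = |dist x w - dist x z| := by
  rw [greedyChain, WellFounded.fix_eq]

theorem dist_add_dist (hz : greedyChain x y z) : dist x z + dist z y = dist x y :=
  (iff_forall_lt.1 hz).1

theorem dist_eq (hw : greedyChain x y w) (hz : greedyChain x y z) :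
    dist w z = |dist x w - dist x z| := by
  rcases trichotomous_of (WellOrderingRel (α := X)) w z with h | rfl | h
  · exact (iff_forall_lt.1 hz).2 w h hw
  · simp
  · rw [dist_comm, abs_sub_comm]
    exact (iff_forall_lt.1 hw).2 z h hz

theorem of_forall (hz : dist x z + dist z y = dist x y)
    (h : ∀ w, greedyChain x y w → dist w z = |dist x w - dist x z|) : greedyChain x y z :=
  iff_forall_lt.2 ⟨hz, fun w _ hw => h w hw⟩

theorem left (x y : X) : greedyChain x y x :=
  of_forall (by simp) fun w _ => by simp [dist_comm]

theorem right (x y : X) : greedyChain x y y :=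
  of_forall (by simp) fun w hw => by
    rw [← hw.dist_add_dist, abs_sub_comm, add_sub_cancel_left, abs_of_nonneg dist_nonneg]

theorem swap (hz : greedyChain x y z) : greedyChain y x z := by
  suffices ∀ x y : X, greedyChain x y z → greedyChain y x z from this x y hz
  clear hz
  induction z using (IsWellFounded.wf (r := WellOrderingRel (α := X))).induction with
  | _ z ih =>
    intro x y hz
    have hxz := hz.dist_add_dist
    refine iff_forall_lt.2 ⟨by linarith [dist_comm x y, dist_comm x z, dist_comm y z], ?_⟩
    intro w hwz hw
    have hw' := ih w hwz y x hw
    have hxw := hw'.dist_add_dist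
    rw [hw'.dist_eq hz, abs_sub_comm]
    congr 1
    linarith [dist_comm y z, dist_comm y w]

theorem iff_of_dist_le (hu : greedyChain x y u) (hv : greedyChain x y v)
    (huv : dist x u ≤ dist x v) :
    greedyChain u v z ↔ greedyChain x y z ∧ dist u z + dist z v = dist u v := by
  have duv : dist u v = dist x v - dist x u := by
    rw [hu.dist_eq hv, abs_sub_comm, abs_of_nonneg (by linarith)]
  induction z using (IsWellFounded.wf (r := WellOrderingRel (α := X))).induction with
  | _ z ih =>
    constructor
    · intro hz
      have huz := hz.dist_add_dist
      have hvy := hv.dist_add_dist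
      have t1 := dist_triangle x u z
      have t2 := dist_triangle z v y
      have t3 := dist_triangle x z y
      have hxz : dist x z = dist x u + dist u z := by linarith
      have huz0 := dist_nonneg (x := u) (y := z)
      have hzv0 := dist_nonneg (x := z) (y := v)
      refine ⟨iff_forall_lt.2 ⟨by linarith, fun w hwz hw => ?_⟩, huz⟩
      have hwu := hw.dist_eq hu
      have hwv := hw.dist_eq hv
      rcases le_total (dist x w) (dist x u) with h1 | h1
      · rw [abs_sub_comm, abs_of_nonneg (by linarith)] at hwu ⊢
        linarith [dist_triangle w u z, dist_triangle x w z]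
      rcases le_total (dist x v) (dist x w) with h2 | h2
      · rw [abs_of_nonneg (by linarith)] at hwv ⊢
        linarith [dist_triangle w v z, dist_triangle x z w, dist_comm w z, dist_comm v z]
      rw [abs_of_nonneg (by linarith)] at hwu
      rw [abs_sub_comm, abs_of_nonneg (by linarith)] at hwv
      have hw' := (ih w hwz).2 ⟨hw, by linarith [dist_comm u w]⟩
      rw [hw'.dist_eq hz]
      congr 1
      linarith [dist_comm u w]
    · rintro ⟨hz, huz⟩
      have key : ∀ w, greedyChain x y w → dist u w + dist w v = dist u v →
          dist u w = dist x w - dist x u := by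
        intro w hw h
        rw [hu.dist_eq hw, hw.dist_eq hv] at h
        rw [hu.dist_eq hw, abs_sub_comm, abs_of_nonneg]
        linarith [neg_le_abs (dist x w - dist x v), neg_le_abs (dist x u - dist x w),
          le_abs_self (dist x u - dist x w), le_abs_self (dist x w - dist x v)]
      refine iff_forall_lt.2 ⟨huz, fun w hwz hw => ?_⟩
      obtain ⟨hw', huw⟩ := (ih w hwz).1 hw
      rw [hw'.dist_eq hz, key w hw' huw, key z hz huz, sub_sub_sub_cancel_right]

theorem trans (hu : greedyChain x y u) (hv : greedyChain x y v) (hz : greedyChain u v z) :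
    greedyChain x y z := by
  rcases le_total (dist x u) (dist x v) with h | h
  · exact ((iff_of_dist_le hu hv h).1 hz).1
  · exact ((iff_of_dist_le hv hu h).1 hz.swap).1

theorem isClosed_setOf (x y : X) : IsClosed {z | greedyChain x y z} := by
  refine isClosed_of_closure_subset fun z hz => of_forall ?_ fun w hw => ?_
  · exact closure_minimal (t := {z | dist x z + dist z y = dist x y})
      (fun z hz => hz.dist_add_dist) (isClosed_eq (by fun_prop) (by fun_prop)) hz
  · exact closure_minimal (t := {z | dist w z = |dist x w - dist x z|})
      (fun z hz => hw.dist_eq hz) (isClosed_eq (by fun_prop) (by fun_prop)) hz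

theorem isClosed_image_dist [CompleteSpace X] (x y : X) :
    IsClosed (dist x '' {z | greedyChain x y z}) := by
  have : CompleteSpace {z | greedyChain x y z} := (isClosed_setOf x y).completeSpace_coe
  have h : Isometry fun z : {z | greedyChain x y z} => dist x z :=
    Isometry.of_dist_eq fun w z => (w.2.dist_eq z.2).symm
  rw [Set.image_eq_range]
  exact h.isClosedEmbedding.isClosed_range

theorem exists_dist_eq [CompleteSpace X] (hgeo : ∀ x y : X, ∃ γ : ℝ → X, IsGeodesicMap x y γ)
    (x y : X) {t : ℝ} (ht : t ∈ Set.Icc 0 (dist x y)) :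
    ∃ z, greedyChain x y z ∧ dist x z = t := by
  have hT := isClosed_image_dist x y
  obtain ⟨⟨p, hp, hpa⟩, hpt⟩ := (hT.inter (isClosed_Iic (a := t))).csSup_mem
    ⟨0, ⟨x, left x y, dist_self x⟩, ht.1⟩ ⟨t, fun _ h => h.2⟩
  obtain ⟨⟨q, hq, hqb⟩, hqt⟩ := (hT.inter (isClosed_Ici (a := t))).csInf_mem
    ⟨dist x y, ⟨y, right x y, rfl⟩, ht.2⟩ ⟨t, fun _ h => h.2⟩
  rw [Set.mem_Iic, ← hpa] at hpt
  rw [Set.mem_Ici, ← hqb] at hqt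
  have hp_max : ∀ w, greedyChain x y w → dist x w ≤ t → dist x w ≤ dist x p := fun w hw h =>
    hpa ▸ le_csSup ⟨t, fun _ h => h.2⟩ ⟨⟨w, hw, rfl⟩, h⟩
  have hq_min : ∀ w, greedyChain x y w → t ≤ dist x w → dist x q ≤ dist x w := fun w hw h =>
    hqb ▸ csInf_le ⟨t, fun _ h => h.2⟩ ⟨⟨w, hw, rfl⟩, h⟩
  have hpq : dist p q = dist x q - dist x p := by
    rw [hp.dist_eq hq, abs_sub_comm, abs_of_nonneg (by linarith)]
  obtain ⟨γ, hγ0, hγ1, hγ⟩ := hgeo p q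
  have hm : t - dist x p ∈ Set.Icc 0 (dist p q) := ⟨by linarith, by linarith⟩
  have hpm := hγ 0 ⟨le_rfl, dist_nonneg⟩ _ hm
  have hmq := hγ _ hm _ ⟨dist_nonneg, le_rfl⟩
  rw [hγ0, abs_sub_comm, sub_zero, abs_of_nonneg hm.1] at hpm
  rw [hγ1, abs_sub_comm, abs_of_nonneg (by linarith [hm.2])] at hmq
  generalize γ (t - dist x p) = m at hpm hmq
  have hqy := hq.dist_add_dist
  have hxm := dist_triangle x p m
  have hmy := dist_triangle m q y
  have hxy := dist_triangle x m y
  have hmt : dist x m = t := by linarith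
  refine ⟨m, of_forall (by linarith) fun w hw => ?_, hmt⟩
  rcases le_total (dist x w) t with h | h
  · have hwp := hw.dist_eq hp
    have := hp_max w hw h
    rw [abs_sub_comm, abs_of_nonneg (by linarith)] at hwp ⊢
    linarith [dist_triangle w p m, dist_triangle x w m]
  · have hwq := hw.dist_eq hq
    have := hq_min w hw h
    rw [abs_of_nonneg (by linarith)] at hwq ⊢
    linarith [dist_triangle w q m, dist_triangle x m w, dist_comm w m, dist_comm q m]

end greedyChain

/-- In a complete geodesic metric space one can choose, for each pair of points `x, y`,
an `(x,y)`-geodesic `γ x y` such that whenever `u, v` lie on (the image of) `γ x y`,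
the image of `γ u v` is contained in the image of `γ x y`. -/
theorem exists_consistent_geodesics
    {X : Type*} [MetricSpace X] [CompleteSpace X]
    (hgeo : ∀ x y : X, ∃ γ : ℝ → X, IsGeodesicMap x y γ) :
    ∃ γ : X → X → ℝ → X,
      (∀ x y : X, IsGeodesicMap x y (γ x y)) ∧
      ∀ x y u v : X,
        u ∈ γ x y '' Set.Icc (0 : ℝ) (dist x y) →
        v ∈ γ x y '' Set.Icc (0 : ℝ) (dist x y) →
        γ u v '' Set.Icc (0 : ℝ) (dist u v) ⊆ γ x y '' Set.Icc (0 : ℝ) (dist x y) := by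
  choose! γ hγ hdist using fun x y t (ht : t ∈ Set.Icc 0 (dist x y)) =>
    greedyChain.exists_dist_eq hgeo x y ht
  have himage : ∀ x y : X, γ x y '' Set.Icc 0 (dist x y) = {z | greedyChain x y z} := by
    intro x y
    ext z
    constructor
    · rintro ⟨t, ht, rfl⟩
      exact hγ x y t ht
    · intro (hz : greedyChain x y z)
      have ht : dist x z ∈ Set.Icc 0 (dist x y) :=
        ⟨dist_nonneg, by linarith [hz.dist_add_dist, dist_nonneg (x := z) (y := y)]⟩
      refine ⟨_, ht, dist_eq_zero.1 ?_⟩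
      rw [(hγ x y _ ht).dist_eq hz, hdist x y _ ht, sub_self, abs_zero]
  refine ⟨γ, fun x y => ⟨?_, ?_, fun s hs t ht => ?_⟩, fun x y u v hu hv => ?_⟩
  · exact (dist_eq_zero.1 (hdist x y 0 ⟨le_rfl, dist_nonneg⟩)).symm
  · have ht : dist x y ∈ Set.Icc 0 (dist x y) := ⟨dist_nonneg, le_rfl⟩
    exact dist_eq_zero.1 (by linarith [(hγ x y _ ht).dist_add_dist, hdist x y _ ht])
  · rw [(hγ x y s hs).dist_eq (hγ x y t ht), hdist x y s hs, hdist x y t ht]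
  · rw [himage] at hu hv ⊢
    rw [himage]
    exact fun z hz => greedyChain.trans hu hv hz
end
end
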